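/- Let μ_{m,n} be the iid standard complex Gaussian matrix measure on m×n complex matrices (the product over entries of the standard complex Gaussian measure on ℂ, defined as the pushforward of (gaussianReal 0 (1/2)) ⊗ (gaussianReal 0 (1/2)) under (x, y) ↦ x + y·Complex.I). Let B be a p×m complex matrix, A an n×n Hermitian positive semidefinite complex matrix, η ≥ 0 a real number, and W an n×n unitary complex matrix. Then ∫ Real.log((det(I_p + η·B·Θ·(W·A·Wᴴ)·Θᴴ·Bᴴ)).re) dμ_{m,n}(Θ) = ∫ Real.log((det(I_p + η·B·Θ·A·Θᴴ·Bᴴ)).re) dμ_{m,n}(Θ). -/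

import Mathlib

open MeasureTheory ProbabilityTheory Matrix ComplexOrder

/-- The measurable space structure on complex matrices, transported from the pi
measurable structure on `Fin m → Fin n → ℂ`. -/
noncomputable instance matrixMeasurableSpace (m n : ℕ) :
    MeasurableSpace (Matrix (Fin m) (Fin n) ℂ) :=
  MeasurableSpace.pi

/-- The standard complex Gaussian measure on `ℂ`: the pushforward of the product of two
real Gaussian measures of mean `0` and variance `1/2` under `(x, y) ↦ x + y * I`. -/
noncomputable def stdComplexGaussian : Measure ℂ :=
  ((gaussianReal 0 (1 / 2)).prod (gaussianReal 0 (1 / 2))).map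
    (fun p : ℝ × ℝ => (p.1 : ℂ) + (p.2 : ℂ) * Complex.I)

/-- The iid standard complex Gaussian matrix measure on `m × n` complex matrices. -/
noncomputable def gaussianMatrix (m n : ℕ) : Measure (Matrix (Fin m) (Fin n) ℂ) :=
  (Measure.pi fun _ : Fin m => Measure.pi fun _ : Fin n => stdComplexGaussian).map
    (fun f => Matrix.of f)

lemma charFun_stdComplexGaussian (t : ℂ) :
    charFun stdComplexGaussian t = Complex.exp (-‖t‖ ^ 2 / 4) := by
  have hinner (p : ℝ × ℝ) : (inner ℝ ((p.1 : ℂ) + (p.2 : ℂ) * Complex.I) t : ℝ) =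
      p.1 * t.re + p.2 * t.im := by
    simp [Complex.inner]
    ring
  have hmeas : Measurable fun p : ℝ × ℝ => (p.1 : ℂ) + (p.2 : ℂ) * Complex.I := by fun_prop
  have hsplit (p : ℝ × ℝ) :
      Complex.exp (((p.1 * t.re + p.2 * t.im : ℝ) : ℂ) * Complex.I) =
        Complex.exp (t.re * p.1 * Complex.I) * Complex.exp (t.im * p.2 * Complex.I) := by
    rw [← Complex.exp_add]
    push_cast
    ring_nf
  rw [charFun_apply, stdComplexGaussian, integral_map hmeas.aemeasurable (by fun_prop)]
  simp_rw [hinner, hsplit]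
  rw [integral_prod_mul (fun x : ℝ => Complex.exp (t.re * x * Complex.I))
      (fun y : ℝ => Complex.exp (t.im * y * Complex.I)),
    ← charFun_apply_real, ← charFun_apply_real, charFun_gaussianReal, charFun_gaussianReal,
    ← Complex.exp_add]
  have hnorm : (‖t‖ : ℂ) ^ 2 = t.re ^ 2 + t.im ^ 2 := by
    rw [← Complex.ofReal_pow, Complex.sq_norm, Complex.normSq_apply]
    push_cast
    ring
  rw [hnorm]
  push_cast
  ring_nf

instance isProbabilityMeasure_stdComplexGaussian : IsProbabilityMeasure stdComplexGaussian :=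
  Measure.isProbabilityMeasure_map (by fun_prop)

lemma charFun_pi_stdComplexGaussian {n : ℕ} (t : EuclideanSpace ℂ (Fin n)) :
    charFun ((Measure.pi fun _ : Fin n => stdComplexGaussian).map (WithLp.toLp 2)) t =
      Complex.exp (-‖t‖ ^ 2 / 4) := by
  rw [charFun_pi]
  simp_rw [charFun_stdComplexGaussian, ← Complex.exp_sum, ← Complex.ofReal_pow,
    EuclideanSpace.norm_sq_eq]
  simp [Finset.sum_div, neg_div]

/-- Right multiplication of matrices by a unitary matrix, as a measurable equivalence. -/
noncomputable def mulRightMeasurableEquiv (m : ℕ) {n : ℕ} (W : Matrix (Fin n) (Fin n) ℂ)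
    (hW : W * Wᴴ = 1) (hW' : Wᴴ * W = 1) :
    Matrix (Fin m) (Fin n) ℂ ≃ᵐ Matrix (Fin m) (Fin n) ℂ where
  toFun Θ := Θ * W
  invFun Θ := Θ * Wᴴ
  left_inv Θ := by simp [Matrix.mul_assoc, hW]
  right_inv Θ := by simp [Matrix.mul_assoc, hW']
  measurable_toFun := measurable_pi_lambda _ fun i => measurable_pi_lambda _ fun j => by
    simp only [Equiv.coe_fn_mk, Matrix.mul_apply]
    exact Finset.measurable_sum _ fun k _ =>
      ((measurable_pi_apply k).comp (measurable_pi_apply i)).mul_const _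
  measurable_invFun := measurable_pi_lambda _ fun i => measurable_pi_lambda _ fun j => by
    simp only [Equiv.coe_fn_symm_mk, Matrix.mul_apply]
    exact Finset.measurable_sum _ fun k _ =>
      ((measurable_pi_apply k).comp (measurable_pi_apply i)).mul_const _

@[simp]
lemma mulRightMeasurableEquiv_apply {m n : ℕ} {W : Matrix (Fin n) (Fin n) ℂ}
    (hW : W * Wᴴ = 1) (hW' : Wᴴ * W = 1) (Θ : Matrix (Fin m) (Fin n) ℂ) :
    mulRightMeasurableEquiv m W hW hW' Θ = Θ * W :=
  rfl

lemma norm_toLp_vecMul_conjTranspose {n : ℕ} {W : Matrix (Fin n) (Fin n) ℂ}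
    (hW' : Wᴴ * W = 1) (t : Fin n → ℂ) :
    ‖WithLp.toLp 2 (t ᵥ* Wᴴ)‖ = ‖WithLp.toLp 2 t‖ := by
  have h (x : Fin n → ℂ) : ((‖WithLp.toLp 2 x‖ ^ 2 : ℝ) : ℂ) = x ⬝ᵥ star x := by
    simpa using (EuclideanSpace.inner_eq_star_dotProduct (𝕜 := ℂ) (WithLp.toLp 2 x)
      (WithLp.toLp 2 x)).symm.trans (inner_self_eq_norm_sq_to_K _) |>.symm
  refine (sq_eq_sq₀ (norm_nonneg _) (norm_nonneg _)).1 (Complex.ofReal_injective ?_)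
  rw [h, h, star_vecMul, conjTranspose_conjTranspose, ← dotProduct_mulVec, mulVec_mulVec, hW',
    one_mulVec]

lemma real_inner_toLp_vecMul {n : ℕ} (W : Matrix (Fin n) (Fin n) ℂ) (x t : Fin n → ℂ) :
    (inner ℝ (WithLp.toLp 2 (x ᵥ* W)) (WithLp.toLp 2 t) : ℝ) =
      inner ℝ (WithLp.toLp 2 x) (WithLp.toLp 2 (t ᵥ* Wᴴ)) := by
  have h (x y : Fin n → ℂ) :
      (inner ℝ (WithLp.toLp 2 x) (WithLp.toLp 2 y) : ℝ) = (y ⬝ᵥ star x).re := by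
    simp [PiLp.inner_apply, Complex.inner, dotProduct, mul_comm]
  rw [h, h, star_vecMul, ← dotProduct_mulVec]

lemma measurePreserving_vecMul_pi_stdComplexGaussian {n : ℕ} (W : Matrix (Fin n) (Fin n) ℂ)
    (hW' : Wᴴ * W = 1) :
    MeasurePreserving (fun v : Fin n → ℂ => v ᵥ* W)
      (Measure.pi fun _ => stdComplexGaussian) (Measure.pi fun _ => stdComplexGaussian) := by
  have hmeas : Measurable fun v : Fin n → ℂ => v ᵥ* W :=
    (Continuous.matrix_vecMul continuous_id continuous_const).measurable
  refine ⟨hmeas, (MeasurableEquiv.toLp 2 (Fin n → ℂ)).map_measurableEquiv_injective ?_⟩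
  have := Measure.isProbabilityMeasure_map (μ := Measure.pi fun _ : Fin n => stdComplexGaussian)
    hmeas.aemeasurable
  rw [MeasurableEquiv.coe_toLp]
  have h1 := Measure.isProbabilityMeasure_map
    (μ := Measure.pi fun _ : Fin n => stdComplexGaussian)
    (WithLp.measurable_toLp 2 (Fin n → ℂ)).aemeasurable
  have h2 := Measure.isProbabilityMeasure_map
    (μ := (Measure.pi fun _ : Fin n => stdComplexGaussian).map (fun v => v ᵥ* W))
    (WithLp.measurable_toLp 2 (Fin n → ℂ)).aemeasurable
  refine Measure.ext_of_charFun (E := EuclideanSpace ℂ (Fin n)) (funext fun t => ?_)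
  have key : charFun (((Measure.pi fun _ : Fin n => stdComplexGaussian).map
        (fun v => v ᵥ* W)).map (WithLp.toLp 2)) t =
      charFun ((Measure.pi fun _ : Fin n => stdComplexGaussian).map (WithLp.toLp 2))
        (WithLp.toLp 2 (WithLp.ofLp t ᵥ* Wᴴ)) := by
    simp_rw [charFun_apply, ← MeasurableEquiv.coe_toLp, integral_map_equiv]
    rw [integral_map hmeas.aemeasurable (by fun_prop)]
    simp_rw [MeasurableEquiv.coe_toLp, ← real_inner_toLp_vecMul]
  rw [key, charFun_pi_stdComplexGaussian, charFun_pi_stdComplexGaussian,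
    norm_toLp_vecMul_conjTranspose hW']

lemma measurePreserving_mulRight_gaussianMatrix (m : ℕ) {n : ℕ} (W : Matrix (Fin n) (Fin n) ℂ)
    (hW : W * Wᴴ = 1) (hWW : Wᴴ * W = 1) :
    MeasurePreserving (mulRightMeasurableEquiv m W hW hWW)
      (gaussianMatrix m n) (gaussianMatrix m n) := by
  have hpi : gaussianMatrix m n =
      Measure.pi fun _ : Fin m => Measure.pi fun _ : Fin n => stdComplexGaussian :=
    Measure.map_id
  rw [hpi]
  exact measurePreserving_pi _ _ fun _ => measurePreserving_vecMul_pi_stdComplexGaussian W hWW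

/-- The Gaussian average of the log-determinant mutual-information
functional is invariant under a unitary conjugation of the inner positive semidefinite
matrix `A`. -/
theorem integral_log_det_unitary_conj_invariant
    (p m n : ℕ) (B : Matrix (Fin p) (Fin m) ℂ) (A : Matrix (Fin n) (Fin n) ℂ)
    (hA : A.PosSemidef) (η : ℝ) (hη : 0 ≤ η)
    (W : Matrix (Fin n) (Fin n) ℂ) (hW : W * Wᴴ = 1) (hW' : Wᴴ * W = 1) :
    (∫ Θ : Matrix (Fin m) (Fin n) ℂ,
        Real.log (((1 + (η : ℂ) • (B * Θ * (W * A * Wᴴ) * Θᴴ * Bᴴ)).det).re)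
      ∂(gaussianMatrix m n)) =
    (∫ Θ : Matrix (Fin m) (Fin n) ℂ,
        Real.log (((1 + (η : ℂ) • (B * Θ * A * Θᴴ * Bᴴ)).det).re)
      ∂(gaussianMatrix m n)) := by
  symm
  rw [← (measurePreserving_mulRight_gaussianMatrix m W hW hW').integral_comp']
  simp only [mulRightMeasurableEquiv_apply, conjTranspose_mul, Matrix.mul_assoc]
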